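/- Let μ be a probability measure on ℝ that is infinitely divisible with infinite Lévy measure, or with a non-zero Gaussian component. Then μ is continuous, i.e., μ({x}) = 0 for every x ∈ ℝ. -/

import Mathlib

open MeasureTheory Complex

section Helpers
open Filter Topology Set

lemma aux_atom (μ : Measure ℝ) [IsProbabilityMeasure μ]
    (h : ∀ δ : ℝ, 0 < δ → ∀ᶠ T : ℝ in atTop,
      (2 * T)⁻¹ * ∫ t in -T..T, ‖charFun μ t‖ ≤ δ) (x0 : ℝ) : μ {x0} = 0 := by
  set μ' := μ.map (· + (-x0)) with hμ'
  have : IsProbabilityMeasure μ' := Measure.isProbabilityMeasure_map (by fun_prop)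
  have hnorm : ∀ t, ‖charFun μ' t‖ = ‖charFun μ t‖ := by
    intro t
    rw [hμ', charFun_map_add_const, norm_mul, Complex.norm_exp_ofReal_mul_I, mul_one]
  have hlim : Tendsto (fun T : ℝ => ∫ x, Real.sinc (T * x) ∂μ') atTop
      (𝓝 (∫ x, Set.indicator {(0 : ℝ)} (fun _ => (1 : ℝ)) x ∂μ')) := by
    refine tendsto_integral_filter_of_dominated_convergence (fun _ => (1 : ℝ)) ?_ ?_ ?_ ?_
    · exact Eventually.of_forall fun T =>
        (Real.continuous_sinc.comp (continuous_const.mul continuous_id)).aestronglyMeasurable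
    · exact Eventually.of_forall fun T => ae_of_all _ fun x => Real.abs_sinc_le_one _
    · exact integrable_const _
    · refine ae_of_all _ fun x => ?_
      by_cases hx : x = 0
      · simp [hx]
      · simp only [mem_singleton_iff, hx, not_false_eq_true, indicator_of_notMem]
        have h1 : Tendsto (fun T : ℝ => |x|⁻¹ * T⁻¹) atTop (𝓝 (|x|⁻¹ * 0)) :=
          tendsto_inv_atTop_zero.const_mul _
        rw [mul_zero] at h1
        refine squeeze_zero_norm' ?_ h1
        filter_upwards [eventually_gt_atTop 0] with T hT
        rw [Real.sinc_of_ne_zero (mul_ne_zero hT.ne' hx), norm_div, Real.norm_eq_abs,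
          Real.norm_eq_abs, abs_mul, abs_of_pos hT, ← mul_inv, mul_comm |x|, div_eq_mul_inv]
        exact mul_le_of_le_one_left (by positivity) (Real.abs_sin_le_one _)
  have hval : (∫ x, Set.indicator {(0 : ℝ)} (fun _ => (1 : ℝ)) x ∂μ') = μ.real {x0} := by
    rw [integral_indicator (measurableSet_singleton _)]
    simp only [integral_const, MeasurableSet.univ, measureReal_restrict_apply, univ_inter,
      smul_eq_mul, mul_one]
    rw [hμ', map_measureReal_apply (by fun_prop) (measurableSet_singleton _)]
    congr 1
    ext y
    simp [add_neg_eq_zero]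
  rw [hval] at hlim
  have hle : μ.real {x0} ≤ 0 := by
    refine le_of_forall_pos_le_add fun δ hδ => ?_
    rw [zero_add]
    refine le_of_tendsto hlim ?_
    filter_upwards [h δ hδ, eventually_gt_atTop 0] with T hT hT0
    refine le_trans ?_ hT
    have h1 := integral_charFun_Icc (μ := μ') hT0
    have h2 : ‖∫ t in -T..T, charFun μ' t‖ ≤ ∫ t in -T..T, ‖charFun μ' t‖ :=
      intervalIntegral.norm_integral_le_integral_norm (by linarith)
    rw [h1] at h2
    simp_rw [hnorm] at h2
    have h3 : ‖(2 * (T : ℂ) * ((∫ x, Real.sinc (T * x) ∂μ' : ℝ) : ℂ))‖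
        = 2 * T * |∫ x, Real.sinc (T * x) ∂μ'| := by
      simp [abs_of_pos hT0]
    rw [h3] at h2
    rw [inv_mul_eq_div, le_div_iff₀ (by positivity)]
    refine le_trans ?_ h2
    rw [mul_comm]
    gcongr
    exact le_abs_self _
  have h0 : μ.real {x0} = 0 := le_antisymm hle measureReal_nonneg
  exact (measureReal_eq_zero_iff (by finiteness)).1 h0

noncomputable def auxJ (l : ℝ) : ℝ := ∫ u in (0 : ℝ)..(2 * Real.pi), Real.exp (-(l * (1 - Real.cos u)))

lemma auxJ_nonneg (l : ℝ) : 0 ≤ auxJ l :=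
  intervalIntegral.integral_nonneg (by positivity) fun _ _ => by positivity

lemma auxJ_tendsto : Tendsto auxJ atTop (𝓝 0) := by
  have h0 : (0 : ℝ) = ∫ u in (0 : ℝ)..(2 * Real.pi), (0 : ℝ) := by simp
  rw [h0]
  unfold auxJ
  refine intervalIntegral.tendsto_integral_filter_of_dominated_convergence (fun _ => (1 : ℝ))
    ?_ ?_ ?_ ?_
  · exact Eventually.of_forall fun l => Continuous.aestronglyMeasurable (by fun_prop)
  · filter_upwards [eventually_ge_atTop 0] with l hl
    refine ae_of_all _ fun u _ => ?_
    rw [Real.norm_eq_abs, abs_of_pos (Real.exp_pos _), Real.exp_le_one_iff]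
    have := mul_nonneg hl (sub_nonneg.2 (Real.cos_le_one u))
    linarith
  · exact intervalIntegrable_const
  · have hc : ∀ᵐ u : ℝ, u ≠ 2 * Real.pi := by
      simp [ae_iff]
    filter_upwards [hc] with u hu hmem
    rw [uIoc_of_le (by positivity)] at hmem
    have hlt : u < 2 * Real.pi := lt_of_le_of_ne hmem.2 hu
    have hcos : Real.cos u ≠ 1 := by
      intro hh
      have := (Real.cos_eq_one_iff_of_lt_of_lt (by linarith [hmem.1, Real.pi_pos]) hlt).1 hh
      exact hmem.1.ne' this
    have hpos : 0 < 1 - Real.cos u := sub_pos.2 (lt_of_le_of_ne (Real.cos_le_one u) hcos)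
    exact Real.tendsto_exp_neg_atTop_nhds_zero.comp (tendsto_id.atTop_mul_const hpos)

lemma aux_periodic (l T x : ℝ) (hT : 0 < T) (hx : 2 * Real.pi ≤ T * |x|) :
    ∫ t in -T..T, Real.exp (-(l * (1 - Real.cos (t * x)))) ≤ 2 * T * (auxJ l / Real.pi) := by
  have hpi := Real.pi_pos
  set a := |x| with ha
  have hapos : 0 < a := by
    by_contra hcon
    have : a ≤ 0 := not_lt.1 hcon
    nlinarith
  set g : ℝ → ℝ := fun u => Real.exp (-(l * (1 - Real.cos u))) with hg
  have hgc : Continuous g := by fun_prop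
  have hgi : ∀ t₁ t₂, IntervalIntegrable g volume t₁ t₂ := fun _ _ => hgc.intervalIntegrable _ _
  have hper : Function.Periodic g (2 * Real.pi) := by
    intro u
    simp [hg]
  have h1 : ∀ t : ℝ, Real.exp (-(l * (1 - Real.cos (t * x)))) = g (t * a) := by
    intro t
    simp only [hg, ha]
    rcases abs_choice x with h | h <;> rw [h]
    rw [mul_neg, Real.cos_neg]
  simp_rw [h1]
  rw [intervalIntegral.integral_comp_mul_right g hapos.ne', smul_eq_mul]
  set n : ℕ := ⌈T * a / (2 * Real.pi)⌉₊ with hn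
  have hn1 : T * a ≤ n * (2 * Real.pi) := by
    have := Nat.le_ceil (T * a / (2 * Real.pi))
    rwa [div_le_iff₀ (by positivity)] at this
  have hn2 : (n : ℝ) ≤ T * a / Real.pi := by
    have h3 := (Nat.ceil_lt_add_one (a := T * a / (2 * Real.pi)) (by positivity)).le
    have h4 : 1 ≤ T * a / (2 * Real.pi) := by rwa [one_le_div (by positivity)]
    have h5 : T * a / Real.pi = T * a / (2 * Real.pi) + T * a / (2 * Real.pi) := by
      field_simp; ring
    rw [h5]; linarith
  have h2 : ∫ u in -T * a..T * a, g u ≤ ∫ u in -(n * (2 * Real.pi))..n * (2 * Real.pi), g u := by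
    refine intervalIntegral.integral_mono_interval (by linarith) (by nlinarith) hn1
      (ae_of_all _ fun u => (Real.exp_pos _).le) (hgi _ _)
  have h6 : ∫ u in -(n * (2 * Real.pi))..n * (2 * Real.pi), g u = 2 * n * auxJ l := by
    have := hper.intervalIntegral_add_zsmul_eq (2 * (n : ℤ)) (-(n * (2 * Real.pi))) hgi
    rw [hper.intervalIntegral_add_eq _ 0, zero_add] at this
    have e : -(n * (2 * Real.pi)) + (2 * (n : ℤ)) • (2 * Real.pi) = n * (2 * Real.pi) := by
      rw [zsmul_eq_mul]; push_cast; ring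
    rw [e] at this
    rw [this, zsmul_eq_mul]
    push_cast
    rfl
  calc a⁻¹ * ∫ u in -T * a..T * a, g u ≤ a⁻¹ * (2 * n * auxJ l) := by
        rw [← h6]; gcongr
    _ ≤ a⁻¹ * (2 * (T * a / Real.pi) * auxJ l) := by
        have := auxJ_nonneg l
        gcongr
    _ = _ := by field_simp

lemma aux_minint (ν : Measure ℝ)
    (hνint : ∫⁻ x, ENNReal.ofReal (min 1 (x ^ 2)) ∂ν ≠ ⊤) :
    Integrable (fun x : ℝ => min 1 (x ^ 2)) ν := by
  refine ⟨Continuous.aestronglyMeasurable (by fun_prop), ?_⟩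
  rw [hasFiniteIntegral_iff_ofReal (ae_of_all _ fun x => by positivity)]
  exact lt_top_iff_ne_top.2 hνint

lemma aux_int (ν : Measure ℝ)
    (hνint : ∫⁻ x, ENNReal.ofReal (min 1 (x ^ 2)) ∂ν ≠ ⊤) (θ : ℝ) :
    Integrable (fun x : ℝ => (Complex.exp (θ * x * Complex.I) - 1 -
          (θ * (if |x| ≤ 1 then x else 0) : ℝ) * Complex.I)) ν := by
  refine Integrable.mono' ((aux_minint ν hνint).const_mul (3 * θ ^ 2 + 2)) ?_ ?_
  · refine Measurable.aestronglyMeasurable ?_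
    have hm : Measurable (fun x : ℝ => if |x| ≤ 1 then x else 0) :=
      Measurable.ite (measurableSet_le (by fun_prop) (by fun_prop)) measurable_id measurable_const
    fun_prop
  · refine ae_of_all _ fun x => ?_
    have hexp : ∀ y : ℝ, ‖Complex.exp (y * I)‖ = 1 := Complex.norm_exp_ofReal_mul_I
    have e : (θ * x * I : ℂ) = ((θ * x : ℝ) : ℂ) * I := by push_cast; ring
    rw [e]
    have htwo : ‖Complex.exp (((θ * x : ℝ) : ℂ) * I) - 1‖ ≤ 2 := by
      refine (norm_sub_le _ _).trans ?_
      rw [hexp]; norm_num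
    by_cases hx : |x| ≤ 1
    · have hx2 : x ^ 2 ≤ 1 := by rw [← sq_abs]; nlinarith [abs_nonneg x]
      rw [if_pos hx, min_eq_right hx2]
      set y := θ * x with hy
      have hn : ‖(y : ℂ) * I‖ = |y| := by simp
      have : ‖Complex.exp ((y : ℂ) * I) - 1 - (y : ℂ) * I‖ ≤ 3 * |y| ^ 2 := by
        by_cases hy1 : |y| ≤ 1
        · have := Complex.norm_exp_sub_one_sub_id_le (x := (y : ℂ) * I) (by rw [hn]; exact hy1)
          rw [hn] at this
          nlinarith [sq_nonneg |y|]
        · have := norm_sub_le (Complex.exp ((y : ℂ) * I) - 1) ((y : ℂ) * I)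
          rw [hn] at this
          nlinarith
      refine this.trans ?_
      rw [sq_abs, hy]
      nlinarith [sq_nonneg x]
    · have hx2 : 1 ≤ x ^ 2 := by rw [← sq_abs]; nlinarith [abs_nonneg x]
      rw [if_neg hx, min_eq_left hx2]
      simp only [mul_zero, ofReal_zero, zero_mul, sub_zero, mul_one]
      nlinarith [sq_nonneg θ]

lemma aux_norm (γ σ2 : ℝ) (ν : Measure ℝ)
    (hνint : ∫⁻ x, ENNReal.ofReal (min 1 (x ^ 2)) ∂ν ≠ ⊤) (A : Set ℝ) (hA : MeasurableSet A)
    (θ : ℝ) :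
    ‖Complex.exp ((γ * θ) * Complex.I - (σ2 * θ ^ 2 / 2 : ℝ) +
        ∫ x, (Complex.exp (θ * x * Complex.I) - 1 -
          (θ * (if |x| ≤ 1 then x else 0) : ℝ) * Complex.I) ∂ν)‖
      ≤ Real.exp (-(σ2 * θ ^ 2 / 2) - ∫ x in A, (1 - Real.cos (θ * x)) ∂ν) := by
  have hint := aux_int ν hνint θ
  rw [Complex.norm_exp, Real.exp_le_exp, Complex.add_re, Complex.sub_re]
  have hre : (∫ x, (Complex.exp (θ * x * Complex.I) - 1 -
          (θ * (if |x| ≤ 1 then x else 0) : ℝ) * Complex.I) ∂ν).re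
      = ∫ x, -(1 - Real.cos (θ * x)) ∂ν := by
    rw [← RCLike.re_eq_complex_re, ← integral_re hint]
    refine integral_congr_ae (ae_of_all _ fun x => ?_)
    have e : (θ * x * I : ℂ) = ((θ * x : ℝ) : ℂ) * I := by push_cast; ring
    simp only [RCLike.re_eq_complex_re]
    rw [e, Complex.sub_re, Complex.sub_re, Complex.exp_ofReal_mul_I_re, Complex.re_ofReal_mul]
    simp
  have hint2 : Integrable (fun x : ℝ => 1 - Real.cos (θ * x)) ν := by
    have := hint.re.neg
    refine this.congr (ae_of_all _ fun x => ?_)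
    have e : (θ * x * I : ℂ) = ((θ * x : ℝ) : ℂ) * I := by push_cast; ring
    simp only [Pi.neg_apply, RCLike.re_eq_complex_re]
    rw [e, Complex.sub_re, Complex.sub_re, Complex.exp_ofReal_mul_I_re, Complex.re_ofReal_mul]
    simp
  rw [hre, integral_neg]
  have h1 : ∫ x in A, (1 - Real.cos (θ * x)) ∂ν ≤ ∫ x, (1 - Real.cos (θ * x)) ∂ν :=
    setIntegral_le_integral hint2 (ae_of_all _ fun x => sub_nonneg.2 (Real.cos_le_one _))
  have h2 : ((γ * θ : ℂ) * I).re = 0 := by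
    rw [← Complex.ofReal_mul, Complex.re_ofReal_mul]; simp
  rw [h2, Complex.ofReal_re]
  linarith

lemma aux_jensen (ν : Measure ℝ) (A : Set ℝ) (h0 : ν A ≠ 0) (ht : ν A ≠ ⊤) (θ : ℝ) :
    Real.exp (-∫ x in A, (1 - Real.cos (θ * x)) ∂ν)
      ≤ ⨍ x in A, Real.exp (-(ν.real A * (1 - Real.cos (θ * x)))) ∂ν := by
  have : IsFiniteMeasure (ν.restrict A) := ⟨by simpa using lt_top_iff_ne_top.2 ht⟩
  have hl : ν.real A ≠ 0 := by
    rw [Measure.real, ENNReal.toReal_ne_zero]; exact ⟨h0, ht⟩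
  have hb : ∀ f : ℝ → ℝ, Continuous f → (∀ x, |f x| ≤ 2 * ν.real A + 1) → IntegrableOn f A ν := by
    intro f hf hbd
    exact Integrable.mono' (integrable_const (2 * ν.real A + 1)) hf.aestronglyMeasurable
      (ae_of_all _ hbd)
  have hnn : 0 ≤ ν.real A := measureReal_nonneg
  have hk := ConvexOn.map_set_average_le (μ := ν) (t := A) (s := univ) (g := Real.exp)
    (f := fun x => -(ν.real A * (1 - Real.cos (θ * x)))) convexOn_exp
    Real.continuous_exp.continuousOn isClosed_univ h0 ht (ae_of_all _ fun _ => mem_univ _)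
    (hb _ (by fun_prop) fun x => by
      have h1 := Real.cos_le_one (θ * x)
      have h2 := Real.neg_one_le_cos (θ * x)
      rw [abs_neg, abs_of_nonneg (mul_nonneg hnn (by linarith))]
      nlinarith)
    (hb _ (by fun_prop) fun x => by
      have h1 := Real.cos_le_one (θ * x)
      simp only [Function.comp]
      rw [abs_of_pos (Real.exp_pos _)]
      have : Real.exp (-(ν.real A * (1 - Real.cos (θ * x)))) ≤ 1 := by
        rw [Real.exp_le_one_iff]
        have := mul_nonneg hnn (sub_nonneg.2 h1)
        linarith
      linarith)
  refine le_trans (le_of_eq ?_) hk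
  congr 1
  rw [setAverage_eq, integral_neg, integral_const_mul, smul_eq_mul]
  field_simp

lemma aux_mean (ν : Measure ℝ) (A : Set ℝ) (hA : MeasurableSet A) (h0 : ν A ≠ 0) (ht : ν A ≠ ⊤)
    (T : ℝ) (hT : 0 < T) (hx : ∀ x ∈ A, 2 * Real.pi ≤ T * |x|) :
    ∫ t in -T..T, ⨍ x in A, Real.exp (-(ν.real A * (1 - Real.cos (t * x)))) ∂ν
      ≤ 2 * T * (auxJ (ν.real A) / Real.pi) := by
  have : IsFiniteMeasure (ν.restrict A) := ⟨by simpa using lt_top_iff_ne_top.2 ht⟩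
  have hnn : 0 ≤ ν.real A := measureReal_nonneg
  have hl : ν.real A ≠ 0 := by
    rw [Measure.real, ENNReal.toReal_ne_zero]; exact ⟨h0, ht⟩
  have hbd : ∀ u : ℝ, Real.exp (-(ν.real A * (1 - Real.cos u))) ≤ 1 := by
    intro u
    rw [Real.exp_le_one_iff]
    have := mul_nonneg hnn (sub_nonneg.2 (Real.cos_le_one u))
    linarith
  have hI : Integrable (Function.uncurry fun (t x : ℝ) =>
      Real.exp (-(ν.real A * (1 - Real.cos (t * x)))))
      ((volume.restrict (Set.uIoc (-T) T)).prod (ν.restrict A)) := by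
    have hfv : IsFiniteMeasure (volume.restrict (Set.uIoc (-T) T)) :=
      ⟨by rw [uIoc_of_le (by linarith)]; simp⟩
    refine Integrable.mono' (integrable_const (1 : ℝ))
      (Continuous.aestronglyMeasurable (by simp only [Function.uncurry_def]; fun_prop)) (ae_of_all _ fun p => ?_)
    simp only [Function.uncurry]
    rw [Real.norm_eq_abs, abs_of_pos (Real.exp_pos _)]
    exact hbd _
  simp_rw [setAverage_eq, smul_eq_mul]
  rw [intervalIntegral.integral_const_mul, intervalIntegral_integral_swap hI,
    inv_mul_le_iff₀ (lt_of_le_of_ne hnn hl.symm)]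
  have hI2 : Integrable (fun x => ∫ t in -T..T, Real.exp (-(ν.real A * (1 - Real.cos (t * x)))))
      (ν.restrict A) := by
    have := hI.integral_prod_right
    simp only [Function.uncurry] at this
    rw [uIoc_of_le (by linarith)] at this
    refine this.congr (ae_of_all _ fun x => ?_)
    simp only
    rw [intervalIntegral.integral_of_le (by linarith)]
  refine (setIntegral_mono_on hI2 (integrable_const (2 * T * (auxJ (ν.real A) / Real.pi))) hA
    fun x hxA => aux_periodic _ T x hT (hx x hxA)).trans (le_of_eq ?_)
  simp

lemma aux_levy (ν : Measure ℝ) (hν0 : ν {0} = 0)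
    (hνint : ∫⁻ x, ENNReal.ofReal (min 1 (x ^ 2)) ∂ν ≠ ⊤) (h : ν Set.univ = ⊤) (M : ℝ) :
    ∃ ε : ℝ, 0 < ε ∧ ν {x | ε ≤ |x|} ≠ ⊤ ∧ M ≤ ν.real {x | ε ≤ |x|} := by
  have hfin : ∀ ε : ℝ, 0 < ε → ν {x | ε ≤ |x|} ≠ ⊤ := by
    intro ε hε
    have := (aux_minint ν hνint).measure_ge_lt_top (ε := min 1 (ε ^ 2)) (by positivity)
    refine ne_top_of_le_ne_top this.ne (measure_mono fun x hx => ?_)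
    simp only [mem_ofPred_eq] at hx ⊢
    refine min_le_min le_rfl ?_
    rw [← sq_abs x]
    gcongr
  have hmono : Monotone (fun n : ℕ => {x : ℝ | 1 / ((n : ℝ) + 1) ≤ |x|}) := by
    intro m n hmn x hx
    simp only [mem_ofPred_eq] at hx ⊢
    exact (Nat.one_div_le_one_div hmn).trans hx
  have hU : (⋃ n : ℕ, {x : ℝ | 1 / ((n : ℝ) + 1) ≤ |x|}) = {0}ᶜ := by
    ext x
    simp only [mem_iUnion, mem_ofPred_eq, mem_compl_iff, mem_singleton_iff]
    constructor
    · rintro ⟨n, hn⟩ rfl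
      have : (0 : ℝ) < 1 / ((n : ℝ) + 1) := by positivity
      rw [abs_zero] at hn; linarith
    · intro hx
      obtain ⟨n, hn⟩ := exists_nat_one_div_lt (abs_pos.2 hx)
      exact ⟨n, hn.le⟩
  have htend := tendsto_measure_iUnion_atTop (μ := ν) hmono
  rw [hU] at htend
  have htop : ν {0}ᶜ = ⊤ := by
    by_contra hne
    have : ν univ ≤ ν {0} + ν {0}ᶜ := by
      rw [← union_compl_self {(0 : ℝ)}]; exact measure_union_le _ _
    rw [h, hν0, zero_add] at this
    exact hne (top_le_iff.1 this)
  rw [htop] at htend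
  have hev := htend.eventually_const_lt (u := ENNReal.ofReal M) ENNReal.ofReal_lt_top
  obtain ⟨n, hn⟩ := hev.exists
  have hp : (0 : ℝ) < 1 / ((n : ℝ) + 1) := by positivity
  refine ⟨1 / ((n : ℝ) + 1), hp, hfin _ hp, ?_⟩
  exact (ENNReal.ofReal_le_iff_le_toReal (hfin _ hp)).1 hn.le

end Helpers




/-- An infinitely divisible distribution on `ℝ` (given by its Lévy–Khintchine
representation with triplet `(γ, σ², ν)`, where `ν` is the Lévy measure) with
infinite Lévy measure or non-zero Gaussian component is continuous. -/
theorem stmt4 (μ : Measure ℝ) [IsProbabilityMeasure μ]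
    (γ σ2 : ℝ) (hσ2 : 0 ≤ σ2) (ν : Measure ℝ)
    (hν0 : ν {0} = 0)
    (hνint : ∫⁻ x, ENNReal.ofReal (min 1 (x ^ 2)) ∂ν ≠ ⊤)
    (hLK : ∀ θ : ℝ, (∫ x, Complex.exp (θ * x * Complex.I) ∂μ) =
      Complex.exp ((γ * θ) * Complex.I - (σ2 * θ ^ 2 / 2 : ℝ) +
        ∫ x, (Complex.exp (θ * x * Complex.I) - 1 -
          (θ * (if |x| ≤ 1 then x else 0) : ℝ) * Complex.I) ∂ν))
    (h : ν Set.univ = ⊤ ∨ 0 < σ2) :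
    ∀ x : ℝ, μ {x} = 0 := by
  have hcf : ∀ θ, charFun μ θ = _ := fun θ => (charFun_apply_real θ).trans (hLK θ)
  have hcont : Continuous (fun t => ‖charFun μ t‖) := (continuous_charFun (μ := μ)).norm
  refine aux_atom μ fun δ hδ => ?_
  rcases h with h | h
  · have hJ : ∀ᶠ l in Filter.atTop, auxJ l / Real.pi < δ := by
      have := auxJ_tendsto.div_const Real.pi
      rw [zero_div] at this
      exact this.eventually_lt_const hδ
    obtain ⟨M, hM⟩ := Filter.eventually_atTop.1 hJ
    obtain ⟨ε, hε, hfin, hge⟩ := aux_levy ν hν0 hνint h (max M 1)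
    set A : Set ℝ := {x | ε ≤ |x|} with hAdef
    have hA : MeasurableSet A := measurableSet_le measurable_const (by fun_prop)
    have hA0 : ν A ≠ 0 := by
      intro h0
      have h1 : ν.real A = 0 := by simp [Measure.real, h0]
      have := (le_max_right M 1).trans hge
      linarith
    filter_upwards [Filter.eventually_ge_atTop (2 * Real.pi / ε)] with T hT
    have hpi := Real.pi_pos
    have hT0 : 0 < T := lt_of_lt_of_le (by positivity) hT
    have hx : ∀ x ∈ A, 2 * Real.pi ≤ T * |x| := by
      intro x hx
      have h1 : 2 * Real.pi ≤ T * ε := by rwa [div_le_iff₀ hε] at hT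
      exact h1.trans (mul_le_mul_of_nonneg_left hx hT0.le)
    have : IsFiniteMeasure (ν.restrict A) := ⟨by simpa using lt_top_iff_ne_top.2 hfin⟩
    have hpt : ∀ t, ‖charFun μ t‖ ≤
        ⨍ x in A, Real.exp (-(ν.real A * (1 - Real.cos (t * x)))) ∂ν := by
      intro t
      rw [hcf]
      refine (aux_norm γ σ2 ν hνint A hA t).trans ?_
      refine le_trans ?_ (aux_jensen ν A hA0 hfin t)
      rw [Real.exp_le_exp]
      have : 0 ≤ σ2 * t ^ 2 / 2 := by positivity
      linarith
    have hc2 : Continuous (fun t : ℝ =>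
        ⨍ x in A, Real.exp (-(ν.real A * (1 - Real.cos (t * x)))) ∂ν) := by
      simp_rw [setAverage_eq]
      simp_rw [smul_eq_mul]
      refine continuous_const.mul ?_
      refine continuous_of_dominated (bound := fun _ => (1 : ℝ))
        (fun t => Continuous.aestronglyMeasurable (by fun_prop)) (fun t => ae_of_all _ fun x => ?_)
        (integrable_const _) (ae_of_all _ fun x => by fun_prop)
      rw [Real.norm_eq_abs, abs_of_pos (Real.exp_pos _), Real.exp_le_one_iff]
      have := mul_nonneg (measureReal_nonneg (μ := ν) (s := A))
        (sub_nonneg.2 (Real.cos_le_one (t * x)))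
      linarith
    have hI := (intervalIntegral.integral_mono (a := -T) (b := T) (μ := volume) (by linarith)
      (hcont.intervalIntegrable _ _) (hc2.intervalIntegrable _ _) hpt).trans
      (aux_mean ν A hA hA0 hfin T hT0 hx)
    rw [inv_mul_le_iff₀ (by positivity)]
    refine hI.trans ?_
    gcongr
    exact (hM _ ((le_max_left M 1).trans hge)).le
  · have hb : 0 < σ2 / 2 := by positivity
    have hlim : Filter.Tendsto (fun T : ℝ => (2 * T)⁻¹ * ∫ t : ℝ, Real.exp (-(σ2 / 2) * t ^ 2))
        Filter.atTop (nhds 0) := by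
      have h1 : Filter.Tendsto (fun T : ℝ => (2 * T)⁻¹) Filter.atTop (nhds 0) :=
        tendsto_inv_atTop_zero.comp (Filter.tendsto_id.const_mul_atTop two_pos)
      have h2 := h1.mul_const (∫ t : ℝ, Real.exp (-(σ2 / 2) * t ^ 2))
      rwa [zero_mul] at h2
    filter_upwards [hlim.eventually_lt_const hδ, Filter.eventually_gt_atTop 0] with T hT hT0
    refine le_trans ?_ hT.le
    gcongr
    have hgi := integrable_exp_neg_mul_sq hb
    have hpt : ∀ t, ‖charFun μ t‖ ≤ Real.exp (-(σ2 / 2) * t ^ 2) := by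
      intro t
      rw [hcf]
      refine (aux_norm γ σ2 ν hνint ∅ MeasurableSet.empty t).trans (le_of_eq ?_)
      congr 1
      simp
      ring
    refine (intervalIntegral.integral_mono (a := -T) (b := T) (μ := volume) (by linarith)
      (hcont.intervalIntegrable _ _) hgi.intervalIntegrable hpt).trans ?_
    rw [intervalIntegral.integral_of_le (by linarith)]
    exact setIntegral_le_integral hgi (ae_of_all _ fun t => (Real.exp_pos _).le)
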